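/- arXiv:1204.5629 — 2 statements merged into one kernel-verified Lean document; each statement's English description precedes it below -/
import Mathlib

section
/- Let N ≥ 1, t > 0, y ∈ W_N and ν ∈ W_N. Define, for x ∈ W_N, the transition density of the noncolliding Brownian motion with drift ν by p_N^ν(t, y|x) = e^{−t|ν|²/2} (det_{1≤j,k≤N}[e^{ν_j y_k}] / det_{1≤j,k≤N}[e^{ν_j x_k}]) q_N(t, y|x). Then, as x tends to the origin within W_N, p_N^ν(t, y|x) converges to t^{−N} (h_N(y/t)/h_N(ν)) q_N(t^{−1}, y/t | ν), where y/t = (y_1/t, …, y_N/t). -/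
open Finset Filter

/-- One-dimensional Gaussian transition density `p(t, y|x) = (2πt)^{-1/2} exp(-(y-x)²/(2t))`. -/
noncomputable def gauss (t y x : ℝ) : ℝ :=
  Real.exp (-(y - x) ^ 2 / (2 * t)) / Real.sqrt (2 * Real.pi * t)

/-- Karlin–McGregor determinant `q_N(t, y|x) = det[p(t, y_j|x_k)]`. -/
noncomputable def qKM (N : ℕ) (t : ℝ) (y x : Fin N → ℝ) : ℝ :=
  Matrix.det (Matrix.of fun j k => gauss t (y j) (x k))

/-- Vandermonde product `h_N(x) = ∏_{j<k} (x_k - x_j)`. -/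
noncomputable def vdm (N : ℕ) (x : Fin N → ℝ) : ℝ :=
  ∏ p ∈ Finset.univ.filter (fun p : Fin N × Fin N => p.1 < p.2), (x p.2 - x p.1)

/-- `det_{1≤j,k≤N}[e^{ν_j y_k}]`. -/
noncomputable def expDet (N : ℕ) (ν y : Fin N → ℝ) : ℝ :=
  Matrix.det (Matrix.of fun j k => Real.exp (ν j * y k))

/-- Transition density of noncolliding BM with drift ν:
`p_N^ν(t, y|x) = e^{-t|ν|²/2} (det[e^{ν_j y_k}]/det[e^{ν_j x_k}]) q_N(t, y|x)`. -/
noncomputable def pDrift (N : ℕ) (ν : Fin N → ℝ) (t : ℝ) (y x : Fin N → ℝ) : ℝ :=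
  Real.exp (-t * (∑ j, ν j ^ 2) / 2) * (expDet N ν y / expDet N ν x) * qKM N t y x

lemma rolle_zeros (i : ℕ) : ∀ (n : ℕ) (g : ℕ → ℝ → ℝ) (_ : ∀ m x, HasDerivAt (g m) (g (m+1) x) x)
    (z : Fin n → ℝ) (_ : StrictMono z) (r : ℝ) (_ : ∀ k, |z k| ≤ r) (_ : ∀ k, g 0 (z k) = 0)
    (_ : i < n), ∃ ξ, |ξ| ≤ r ∧ g i ξ = 0 := by
  induction i with
  | zero =>
    intro n g hg z hz r hr h0 hi
    exact ⟨z ⟨0, hi⟩, hr _, h0 _⟩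
  | succ i ih =>
    intro n g hg z hz r hr h0 hi
    obtain ⟨n, rfl⟩ : ∃ m, n = m + 1 := ⟨n - 1, by omega⟩
    have key : ∀ k : Fin n, ∃ c ∈ Set.Ioo (z k.castSucc) (z k.succ), g 1 c = 0 := by
      intro k
      refine exists_hasDerivAt_eq_zero (f := g 0) (hz (Fin.castSucc_lt_succ)) ?_ ?_ ?_
      · exact fun x _ => (hg 0 x).continuousAt.continuousWithinAt
      · rw [h0, h0]
      · exact fun x _ => hg 0 x
    choose c hc hc0 using key
    refine ih n (fun m => g (m+1)) (fun m x => hg (m+1) x) c ?_ r ?_ hc0 (by omega)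
    · intro a b hab
      refine (hc a).2.trans_le (le_trans (hz.monotone ?_) (hc b).1.le)
      rw [Fin.le_def]
      simp only [Fin.val_succ, Fin.val_castSucc]
      exact hab
    · intro k
      rw [abs_le]
      have h1 := abs_le.1 (hr k.castSucc)
      have h2 := abs_le.1 (hr k.succ)
      exact ⟨h1.1.trans (hc k).1.le, (hc k).2.le.trans h2.2⟩

open Polynomial in
lemma coeff_conv {ι : Type*} (l : Filter ι) (N : ℕ) (P : ι → ℝ[X]) (hP : ∀ᶠ x in l, (P x).degree < N)
    (a : ℝ) (ξ : ι → ℕ → ℝ) (hξ : ∀ i, i < N → Tendsto (fun x => ξ x i) l (nhds 0))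
    (he : ∀ i, i < N → ∀ᶠ x in l, (derivative^[i] (P x)).eval (ξ x i) = a ^ i * Real.exp (a * ξ x i)) :
    ∀ d i, N ≤ i + d → Tendsto (fun x => (P x).coeff i) l
      (nhds (if i < N then a ^ i / (i.factorial : ℝ) else 0)) := by
  have big : ∀ i, N ≤ i → Tendsto (fun x => (P x).coeff i) l (nhds 0) := by
    intro i hi
    refine tendsto_const_nhds.congr' ?_
    filter_upwards [hP] with x hx
    exact ((degree_lt_iff_coeff_zero _ _).1 hx i hi).symm
  intro d
  induction d with
  | zero =>
    intro i hi
    rw [if_neg (by omega)]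
    exact big i (by omega)
  | succ d ih =>
    intro i hi
    by_cases hiN : i < N
    swap
    · rw [if_neg hiN]; exact big i (by omega)
    rw [if_pos hiN]
    obtain ⟨n, rfl⟩ : ∃ m, N = m + 1 := ⟨N - 1, by omega⟩
    have hsum : Tendsto (fun x => ∑ m ∈ Finset.range n,
        ((m + 1 + i).descFactorial i : ℝ) * (P x).coeff (m + 1 + i) * (ξ x i) ^ (m + 1)) l (nhds 0) := by
      rw [← Finset.sum_const_zero (s := Finset.range n)]
      refine tendsto_finset_sum _ fun m _ => ?_
      have h1 := ih (m + 1 + i) (by omega)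
      have h2 := (tendsto_const_nhds (x := ((m + 1 + i).descFactorial i : ℝ)) (f := l)).mul h1
      have h3 := h2.mul ((hξ i hiN).pow (m + 1))
      simpa using h3
    have hexp : Tendsto (fun x => a ^ i * Real.exp (a * ξ x i)) l (nhds (a ^ i)) := by
      have : Continuous fun s : ℝ => a ^ i * Real.exp (a * s) := by fun_prop
      have h := (this.tendsto 0).comp (hξ i hiN)
      simp only [mul_zero, Real.exp_zero, mul_one] at h
      exact h
    have := (hexp.sub hsum).div_const (i.factorial : ℝ)
    rw [sub_zero] at this
    refine this.congr' ?_
    filter_upwards [hP, he i hiN] with x hx hex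
    have hf : (i.factorial : ℝ) ≠ 0 := by positivity
    rw [div_eq_iff hf, ← hex]
    have hnd : (derivative^[i] (P x)).natDegree < n + 1 := by
      refine lt_of_le_of_lt (natDegree_iterate_derivative _ _) ?_
      have : (P x).natDegree ≤ n := by
        rw [natDegree_le_iff_coeff_eq_zero]
        intro m hm
        exact (degree_lt_iff_coeff_zero _ _).1 hx m (by omega)
      omega
    rw [eval_eq_sum_range' hnd, Finset.sum_range_succ']
    simp only [coeff_iterate_derivative, nsmul_eq_mul, zero_add, pow_zero, mul_one,
      Nat.descFactorial_self]
    ring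

lemma vdm_eq (N : ℕ) (x : Fin N → ℝ) : vdm N x = (Matrix.vandermonde x).det := by
  rw [Matrix.det_vandermonde, vdm, Finset.prod_filter, ← Finset.univ_product_univ,
    Finset.prod_product]
  refine Finset.prod_congr rfl fun i _ => ?_
  rw [← Finset.prod_filter]
  refine Finset.prod_congr ?_ fun _ _ => rfl
  ext; simp

lemma vdm_ne (N : ℕ) (x : Fin N → ℝ) (hx : StrictMono x) : vdm N x ≠ 0 := by
  rw [vdm_eq, Matrix.det_vandermonde_ne_zero_iff]
  exact hx.injective

open Polynomial in
lemma expDet_conv (N : ℕ) (a : Fin N → ℝ) :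
    Tendsto (fun x => expDet N a x / vdm N x) (nhdsWithin 0 {x : Fin N → ℝ | StrictMono x})
      (nhds (vdm N a * ∏ i : Fin N, ((i : ℕ).factorial : ℝ)⁻¹)) := by
  set l := nhdsWithin (0 : Fin N → ℝ) {x : Fin N → ℝ | StrictMono x} with hl
  have hmem : ∀ᶠ x in l, StrictMono x := self_mem_nhdsWithin
  let P : Fin N → (Fin N → ℝ) → ℝ[X] := fun j x =>
    Lagrange.interpolate Finset.univ x (fun k => Real.exp (a j * x k))
  have hdeg : ∀ j x, StrictMono x → (P j x).degree < N := by
    intro j x hx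
    have := Lagrange.degree_interpolate_lt (s := Finset.univ) (v := x)
      (r := fun k => Real.exp (a j * x k)) hx.injective.injOn
    rw [Finset.card_univ, Fintype.card_fin] at this
    exact this
  have hnode : ∀ j x, StrictMono x → ∀ k, (P j x).eval (x k) = Real.exp (a j * x k) := by
    intro j x hx k
    exact Lagrange.eval_interpolate_at_node _ hx.injective.injOn (Finset.mem_univ k)
  have hz : ∀ j x i, ∃ ξ : ℝ, StrictMono x → i < N → |ξ| ≤ ‖x‖ ∧
      (derivative^[i] (P j x)).eval ξ = a j ^ i * Real.exp (a j * ξ) := by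
    intro j x i
    by_cases h : StrictMono x ∧ i < N
    swap
    · exact ⟨0, fun h1 h2 => absurd ⟨h1, h2⟩ h⟩
    obtain ⟨ξ, h1, h2⟩ := rolle_zeros i N
      (fun m s => (derivative^[m] (P j x)).eval s - a j ^ m * Real.exp (a j * s))
      (by
        intro m s
        have e1 := (derivative^[m] (P j x)).hasDerivAt s
        have e2 : HasDerivAt (fun s => a j ^ m * Real.exp (a j * s))
            (a j ^ m * (Real.exp (a j * s) * (a j * 1))) s :=
          (((hasDerivAt_id s).const_mul (a j)).exp).const_mul _
        have e3 := e1.sub e2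
        have e4 : (derivative^[m+1] (P j x)).eval s - a j ^ (m+1) * Real.exp (a j * s) =
            (derivative (derivative^[m] (P j x))).eval s
              - a j ^ m * (Real.exp (a j * s) * (a j * 1)) := by
          rw [Function.iterate_succ_apply']
          ring
        rw [← e4] at e3
        exact e3)
      x h.1 ‖x‖ (fun k => norm_le_pi_norm x k)
      (by intro k; simp [hnode j x h.1 k]) h.2
    exact ⟨ξ, fun _ _ => ⟨h1, sub_eq_zero.1 h2⟩⟩
  choose ξ hξ using hz
  have hnorm : Tendsto (fun x : Fin N → ℝ => ‖x‖) l (nhds 0) := by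
    have : Tendsto (fun x : Fin N → ℝ => ‖x‖) (nhds 0) (nhds 0) := by
      simpa using (continuous_norm (E := Fin N → ℝ)).tendsto 0
    exact this.mono_left nhdsWithin_le_nhds
  have hC : ∀ j (i : Fin N), Tendsto (fun x => (P j x).coeff i) l
      (nhds (a j ^ (i : ℕ) / ((i : ℕ).factorial : ℝ))) := by
    intro j i
    have := coeff_conv l N (P j) (hmem.mono fun x hx => hdeg j x hx) (a j) (ξ j)
      (by
        intro i hi
        refine squeeze_zero_norm' ?_ hnorm
        filter_upwards [hmem] with x hx
        exact (hξ j x i hx hi).1)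
      (by
        intro i hi
        filter_upwards [hmem] with x hx
        exact (hξ j x i hx hi).2) N i (by omega)
    rwa [if_pos i.2] at this
  have hdet : Tendsto (fun x => Matrix.det (Matrix.of fun j i : Fin N => (P j x).coeff i)) l
      (nhds (Matrix.det (Matrix.of fun j i : Fin N => a j ^ (i : ℕ) / ((i : ℕ).factorial : ℝ)))) := by
    have hcont : Continuous fun M : Matrix (Fin N) (Fin N) ℝ => M.det := continuous_id.matrix_det
    refine (hcont.tendsto _).comp ?_
    refine tendsto_pi_nhds.2 fun j => tendsto_pi_nhds.2 fun i => hC j i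
  have hlim : Matrix.det (Matrix.of fun j i : Fin N => a j ^ (i : ℕ) / ((i : ℕ).factorial : ℝ))
      = vdm N a * ∏ i : Fin N, ((i : ℕ).factorial : ℝ)⁻¹ := by
    rw [vdm_eq, mul_comm, ← Matrix.det_mul_row]
    congr 1
    ext j i
    simp [Matrix.vandermonde_apply, div_eq_inv_mul]
  rw [← hlim]
  refine hdet.congr' ?_
  filter_upwards [hmem] with x hx
  rw [eq_div_iff (vdm_ne N x hx), vdm_eq, ← Matrix.det_transpose (Matrix.vandermonde x),
    ← Matrix.det_mul, expDet]
  congr 1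
  ext j k
  rw [Matrix.mul_apply, Matrix.of_apply, ← hnode j x hx k]
  have hnd : (P j x).natDegree < N := by
    have hN : 0 < N := j.pos
    have : (P j x).natDegree ≤ N - 1 := by
      rw [natDegree_le_iff_coeff_eq_zero]
      intro m hm
      exact (degree_lt_iff_coeff_zero _ _).1 (hdeg j x hx) m (by omega)
    omega
  rw [eval_eq_sum_range' hnd, ← Fin.sum_univ_eq_sum_range (fun i => (P j x).coeff i * x k ^ i)]
  simp [Matrix.vandermonde_apply]

lemma qKM_eq (N : ℕ) (t : ℝ) (ht : 0 < t) (y x : Fin N → ℝ) :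
    qKM N t y x = (∏ j, Real.exp (-(y j) ^ 2 / (2 * t)) / Real.sqrt (2 * Real.pi * t)) *
      ((∏ k, Real.exp (-(x k) ^ 2 / (2 * t))) * expDet N (fun j => y j / t) x) := by
  rw [expDet, ← Matrix.det_mul_row, ← Matrix.det_mul_column, qKM]
  congr 1
  ext j k
  simp only [Matrix.of_apply, gauss]
  rw [div_mul_eq_mul_div, ← Real.exp_add, ← Real.exp_add]
  congr 2
  field_simp
  ring

lemma expDet_symm (N : ℕ) (x y : Fin N → ℝ) : expDet N x y = expDet N y x := by
  rw [expDet, expDet, ← Matrix.det_transpose]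
  congr 1
  ext j k
  simp [mul_comm]

lemma const_eq (N : ℕ) (t : ℝ) (ht : 0 < t) (y ν : Fin N → ℝ) :
    Real.exp (-t * (∑ j, ν j ^ 2) / 2) *
      (∏ j, Real.exp (-(y j) ^ 2 / (2 * t)) / Real.sqrt (2 * Real.pi * t)) =
    t ^ (-(N : ℤ)) * ((∏ j, Real.exp (-(y j / t) ^ 2 / (2 * t⁻¹)) / Real.sqrt (2 * Real.pi * t⁻¹)) *
      (∏ k, Real.exp (-(ν k) ^ 2 / (2 * t⁻¹)))) := by
  have h1 : Real.exp (-t * (∑ j, ν j ^ 2) / 2) = ∏ k, Real.exp (-(ν k) ^ 2 / (2 * t⁻¹)) := by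
    rw [← Real.exp_sum]
    congr 1
    rw [Finset.mul_sum, Finset.sum_div]
    refine Finset.sum_congr rfl fun k _ => ?_
    field_simp
  have h2 : t ^ (-(N : ℤ)) = ∏ _j : Fin N, t⁻¹ := by
    simp
  have h3 : (∏ j, Real.exp (-(y j) ^ 2 / (2 * t)) / Real.sqrt (2 * Real.pi * t)) =
      (∏ _j : Fin N, t⁻¹) *
      ∏ j, Real.exp (-(y j / t) ^ 2 / (2 * t⁻¹)) / Real.sqrt (2 * Real.pi * t⁻¹) := by
    rw [← Finset.prod_mul_distrib]
    refine Finset.prod_congr rfl fun j _ => ?_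
    have e1 : -(y j / t) ^ 2 / (2 * t⁻¹) = -(y j) ^ 2 / (2 * t) := by field_simp
    have e2 : Real.sqrt (2 * Real.pi * t) = t * Real.sqrt (2 * Real.pi * t⁻¹) := by
      have : 2 * Real.pi * t = t ^ 2 * (2 * Real.pi * t⁻¹) := by field_simp
      rw [this, Real.sqrt_mul (by positivity), Real.sqrt_sq ht.le]
    rw [e1, e2]
    field_simp
  rw [h1, h2, h3]
  ring

/-- As the initial configuration `x` tends to the origin within the Weyl chamber,
`p_N^ν(t, y|x)` converges to `t^{-N} (h_N(y/t)/h_N(ν)) q_N(t⁻¹, y/t|ν)`. -/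
theorem pDrift_tendsto_origin
    (N : ℕ) (hN : 1 ≤ N) (t : ℝ) (ht : 0 < t)
    (y ν : Fin N → ℝ) (hy : StrictMono y) (hν : StrictMono ν) :
    Tendsto (fun x : Fin N → ℝ => pDrift N ν t y x)
      (nhdsWithin 0 {x : Fin N → ℝ | StrictMono x})
      (nhds (t ^ (-(N : ℤ)) * (vdm N (fun j => y j / t) / vdm N ν) *
        qKM N t⁻¹ (fun j => y j / t) ν)) := by
  set l := nhdsWithin (0 : Fin N → ℝ) {x : Fin N → ℝ | StrictMono x} with hl
  have hmem : ∀ᶠ x in l, StrictMono x := self_mem_nhdsWithin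
  have hF : (∏ i : Fin N, ((i : ℕ).factorial : ℝ)⁻¹) ≠ 0 :=
    Finset.prod_ne_zero_iff.2 fun i _ => by positivity
  have hr := (expDet_conv N (fun j => y j / t)).div (expDet_conv N ν)
    (mul_ne_zero (vdm_ne N ν hν) hF)
  rw [mul_div_mul_right _ _ hF] at hr
  have hg : Tendsto (fun x : Fin N → ℝ => ∏ k, Real.exp (-(x k) ^ 2 / (2 * t))) l (nhds 1) := by
    have : Continuous (fun x : Fin N → ℝ => ∏ k, Real.exp (-(x k) ^ 2 / (2 * t))) := by fun_prop
    have h := this.tendsto 0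
    simp only [Pi.zero_apply, ne_eq, OfNat.ofNat_ne_zero, not_false_eq_true, zero_pow, neg_zero,
      zero_div, Real.exp_zero, Finset.prod_const_one] at h
    exact h.mono_left nhdsWithin_le_nhds
  have htot := (hg.mul hr).const_mul (Real.exp (-t * (∑ j, ν j ^ 2) / 2) *
      (∏ j, Real.exp (-(y j) ^ 2 / (2 * t)) / Real.sqrt (2 * Real.pi * t)) * expDet N ν y)
  have hy' : (fun j => y j / t / t⁻¹) = y := by
    funext j
    field_simp
  have hval : t ^ (-(N : ℤ)) * (vdm N (fun j => y j / t) / vdm N ν) *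
        qKM N t⁻¹ (fun j => y j / t) ν = Real.exp (-t * (∑ j, ν j ^ 2) / 2) *
      (∏ j, Real.exp (-(y j) ^ 2 / (2 * t)) / Real.sqrt (2 * Real.pi * t)) * expDet N ν y *
      (1 * (vdm N (fun j => y j / t) / vdm N ν)) := by
    rw [const_eq N t ht y ν, qKM_eq N t⁻¹ (inv_pos.2 ht), hy', expDet_symm N y ν]
    ring
  rw [hval]
  refine htot.congr' ?_
  filter_upwards [hmem] with x hx
  rw [Pi.div_apply, div_div_div_cancel_right₀ (vdm_ne N x hx), pDrift, qKM_eq N t ht]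
  ring
end

section
/- Let N ≥ 1 and fix x, y ∈ W_N. Then, as ν tends to 0 within the Weyl chamber W_N, the ratio det_{1≤j,k≤N}[e^{ν_j y_k}] / det_{1≤j,k≤N}[e^{ν_j x_k}] converges to h_N(y)/h_N(x). -/
open Finset Filter

namespace ExpDetAux
open Matrix NormedSpace

attribute [local instance] Matrix.linftyOpNormedAddCommGroup Matrix.linftyOpNormedSpace
  Matrix.linftyOpNormedRing Matrix.linftyOpNormedAlgebra

noncomputable def shiftM (N : ℕ) : Matrix (Fin N) (Fin N) ℝ :=
  Matrix.of fun i k => if (i : ℕ) = k + 1 then 1 else 0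

noncomputable def AM (N : ℕ) (ν : Fin N → ℝ) : Matrix (Fin N) (Fin N) ℝ :=
  Matrix.diagonal ν + shiftM N

noncomputable def nwt (N : ℕ) (ν : Fin N → ℝ) (i : ℕ) (t : ℝ) : ℝ :=
  ∏ l ∈ Finset.univ.filter (fun l : Fin N => (l : ℕ) < i), (t - ν l)

noncomputable def VM (N : ℕ) (ν : Fin N → ℝ) : Matrix (Fin N) (Fin N) ℝ :=
  Matrix.of fun j i => nwt N ν i (ν j)

noncomputable def BM (N : ℕ) (z : Fin N) (ν y : Fin N → ℝ) : Matrix (Fin N) (Fin N) ℝ :=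
  Matrix.of fun i k => (NormedSpace.exp (y k • AM N ν)) i z

lemma nwt_succ (N : ℕ) (ν : Fin N → ℝ) (k : Fin N) (t : ℝ) :
    nwt N ν (k + 1) t = (t - ν k) * nwt N ν k t := by
  unfold nwt
  have : Finset.univ.filter (fun l : Fin N => (l : ℕ) < k + 1)
      = insert k (Finset.univ.filter (fun l : Fin N => (l : ℕ) < k)) := by
    ext l
    simp [Fin.ext_iff]
    omega
  rw [this, Finset.prod_insert (by simp)]

lemma nwt_zero_of_lt (N : ℕ) (ν : Fin N → ℝ) (i : ℕ) (j : Fin N) (h : (j : ℕ) < i) :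
    nwt N ν i (ν j) = 0 := by
  unfold nwt
  exact Finset.prod_eq_zero (i := j) (by simp [h]) (by simp)

lemma V_mul_A (N : ℕ) (ν : Fin N → ℝ) : VM N ν * AM N ν = Matrix.diagonal ν * VM N ν := by
  ext j k
  rw [AM, Matrix.mul_add, Matrix.add_apply, Matrix.mul_diagonal, Matrix.diagonal_mul]
  have h2 : (VM N ν * shiftM N) j k = nwt N ν (k + 1) (ν j) := by
    rw [Matrix.mul_apply]
    simp only [VM, shiftM, Matrix.of_apply]
    by_cases hk : (k : ℕ) + 1 < N
    · rw [Finset.sum_eq_single ⟨k + 1, hk⟩]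
      · simp
      · intro b _ hb
        rw [if_neg, mul_zero]
        intro h
        exact hb (Fin.ext h)
      · simp
    · rw [nwt_zero_of_lt N ν _ j (by omega)]
      apply Finset.sum_eq_zero
      intro b _
      rw [if_neg (by omega), mul_zero]
  rw [h2, nwt_succ]
  simp only [VM, Matrix.of_apply]
  ring

lemma V_det_ne (N : ℕ) (ν : Fin N → ℝ) (h : StrictMono ν) : (VM N ν).det ≠ 0 := by
  rw [Matrix.det_of_isLowerTriangular]
  · rw [Finset.prod_ne_zero_iff]
    intro i _
    simp only [VM, Matrix.of_apply, nwt]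
    rw [Finset.prod_ne_zero_iff]
    intro l hl
    simp only [Finset.mem_filter, Finset.mem_univ, true_and] at hl
    have : ν l < ν i := h hl
    exact sub_ne_zero.mpr this.ne'
  · intro i j hij
    exact nwt_zero_of_lt N ν _ i (by simpa using hij)

lemma V_exp (N : ℕ) (ν : Fin N → ℝ) (h : StrictMono ν) (c : ℝ) :
    VM N ν * NormedSpace.exp (c • AM N ν)
      = Matrix.diagonal (fun j => Real.exp (ν j * c)) * VM N ν := by
  have hu : IsUnit (VM N ν) := by
    rw [Matrix.isUnit_iff_isUnit_det]
    exact (V_det_ne N ν h).isUnit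
  have hd : IsUnit (VM N ν).det := (V_det_ne N ν h).isUnit
  have hA : c • AM N ν = (VM N ν)⁻¹ * Matrix.diagonal (fun j => ν j * c) * VM N ν := by
    have : Matrix.diagonal (fun j => ν j * c) = c • Matrix.diagonal ν := by
      rw [← Matrix.diagonal_smul]
      congr 1; ext j; simp [mul_comm]
    rw [this, Matrix.mul_smul, Matrix.smul_mul, Matrix.mul_assoc, ← V_mul_A,
      Matrix.nonsing_inv_mul_cancel_left _ _ hd]
  rw [hA, Matrix.exp_conj' _ _ hu, Matrix.mul_assoc, Matrix.mul_nonsing_inv_cancel_left _ _ hd,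
    Matrix.exp_diagonal]
  congr 2
  ext j
  rw [Pi.coe_exp, Real.exp_eq_exp_ℝ]

lemma expDet_eq (N : ℕ) (z : Fin N) (hz : (z : ℕ) = 0) (ν y : Fin N → ℝ) (h : StrictMono ν) :
    expDet N ν y = (VM N ν).det * (BM N z ν y).det := by
  rw [expDet, ← Matrix.det_mul]
  congr 1
  ext j k
  have := congrFun (congrFun (V_exp N ν h (y k)) j) z
  rw [Matrix.diagonal_mul] at this
  have hV : VM N ν j z = 1 := by
    simp only [VM, nwt, Matrix.of_apply, hz]
    simp
  rw [hV, mul_one] at this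
  rw [Matrix.of_apply, ← this, Matrix.mul_apply, Matrix.mul_apply]
  rfl

lemma B_cont (N : ℕ) (z : Fin N) (y : Fin N → ℝ) :
    Continuous (fun ν => (BM N z ν y).det) := by
  apply Continuous.matrix_det
  apply continuous_matrix
  intro i k
  simp only [BM, Matrix.of_apply]
  have hA : Continuous (fun ν => y k • AM N ν) := by
    unfold AM
    have h1 : Continuous (fun ν : Fin N → ℝ => Matrix.diagonal ν) :=
      Continuous.matrix_diagonal continuous_id
    exact (h1.add continuous_const).const_smul (y k)
  have hE : Continuous (NormedSpace.exp : Matrix (Fin N) (Fin N) ℝ → Matrix (Fin N) (Fin N) ℝ) :=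
    NormedSpace.exp_continuous
  exact (hE.comp hA).matrix_elem i z

lemma shift_pow (N : ℕ) (z : Fin N) (hz : (z : ℕ) = 0) (m : ℕ) (i : Fin N) :
    (shiftM N ^ m) i z = if (i : ℕ) = m then 1 else 0 := by
  induction m generalizing i with
  | zero => simp [Matrix.one_apply, Fin.ext_iff, hz]
  | succ m ih =>
    rw [pow_succ', Matrix.mul_apply]
    simp only [ih]
    by_cases hi : (i : ℕ) = m + 1
    · rw [if_pos hi, Finset.sum_eq_single ⟨m, by omega⟩]
      · simp [shiftM, hi]
      · intro b _ hb
        rw [if_neg, mul_zero]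
        intro h; exact hb (Fin.ext h)
      · simp
    · rw [if_neg hi]
      apply Finset.sum_eq_zero
      intro b _
      by_cases hb : (b : ℕ) = m
      · simp [shiftM, hb, hi]
      · simp [hb]

lemma exp_shift (N : ℕ) (z : Fin N) (hz : (z : ℕ) = 0) (c : ℝ) (i : Fin N) :
    (NormedSpace.exp (c • shiftM N)) i z = ((i : ℕ).factorial : ℝ)⁻¹ * c ^ (i : ℕ) := by
  have h := NormedSpace.exp_series_hasSum_exp' (𝕂 := ℝ) (c • shiftM N)
  have h2 := h.map ((Matrix.entryAddMonoidHom ℝ i z) : Matrix (Fin N) (Fin N) ℝ →+ ℝ)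
    (continuous_id.matrix_elem i z)
  have h3 := hasSum_single (f := (Matrix.entryAddMonoidHom ℝ i z) ∘
    fun n : ℕ => ((n.factorial : ℝ)⁻¹) • (c • shiftM N) ^ n) (i : ℕ) (by
      intro n hn
      simp [smul_pow, shift_pow N z hz, hn.symm])
  have := h2.unique h3
  simp [smul_pow, shift_pow N z hz] at this
  exact this

lemma vdm_eq (N : ℕ) (y : Fin N → ℝ) : vdm N y = (Matrix.vandermonde y).det := by
  rw [Matrix.det_vandermonde, vdm, Finset.prod_filter, ← Finset.univ_product_univ,
    Finset.prod_product]
  apply Finset.prod_congr rfl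
  intro i _
  rw [← Finset.prod_filter]
  apply Finset.prod_congr
  · ext; simp
  · simp

lemma B_zero (N : ℕ) (z : Fin N) (hz : (z : ℕ) = 0) (y : Fin N → ℝ) :
    (BM N z 0 y).det = (∏ i : Fin N, ((i : ℕ).factorial : ℝ)⁻¹) * vdm N y := by
  rw [vdm_eq, ← Matrix.det_transpose (Matrix.vandermonde y), ← Matrix.det_diagonal,
    ← Matrix.det_mul]
  congr 1
  ext i k
  rw [Matrix.diagonal_mul, BM, Matrix.of_apply]
  have : AM N 0 = shiftM N := by
    unfold AM
    simp
  rw [this, exp_shift N z hz]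
  rfl

end ExpDetAux

/-- As the drift `ν` tends to `0` within the Weyl chamber, the ratio
`det[e^{ν_j y_k}] / det[e^{ν_j x_k}]` converges to `h_N(y)/h_N(x)`. -/
theorem expDet_ratio_tendsto
    (N : ℕ) (hN : 1 ≤ N) (x y : Fin N → ℝ)
    (hx : StrictMono x) (hy : StrictMono y) :
    Tendsto (fun ν : Fin N → ℝ => expDet N ν y / expDet N ν x)
      (nhdsWithin 0 {ν : Fin N → ℝ | StrictMono ν})
      (nhds (vdm N y / vdm N x)) := by
  have hz : ((⟨0, hN⟩ : Fin N) : ℕ) = 0 := rfl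
  generalize (⟨0, hN⟩ : Fin N) = z at hz
  have hC : (∏ i : Fin N, ((i : ℕ).factorial : ℝ)⁻¹) ≠ 0 :=
    Finset.prod_ne_zero_iff.mpr fun i _ => inv_ne_zero (by positivity)
  have hvx : vdm N x ≠ 0 := by
    rw [ExpDetAux.vdm_eq]
    exact Matrix.det_vandermonde_ne_zero_iff.mpr hx.injective
  have hlim : Tendsto (fun ν : Fin N → ℝ =>
      (ExpDetAux.BM N z ν y).det / (ExpDetAux.BM N z ν x).det)
      (nhdsWithin 0 {ν : Fin N → ℝ | StrictMono ν}) (nhds (vdm N y / vdm N x)) := by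
    have h := ((ExpDetAux.B_cont N z y).tendsto 0).div ((ExpDetAux.B_cont N z x).tendsto 0)
      (by rw [ExpDetAux.B_zero N z hz]; exact mul_ne_zero hC hvx)
    rw [ExpDetAux.B_zero N z hz, ExpDetAux.B_zero N z hz, mul_div_mul_left _ _ hC] at h
    exact h.mono_left nhdsWithin_le_nhds
  refine hlim.congr' ?_
  filter_upwards [self_mem_nhdsWithin] with ν hν
  rw [ExpDetAux.expDet_eq N z hz ν y hν, ExpDetAux.expDet_eq N z hz ν x hν,
    mul_div_mul_left _ _ (ExpDetAux.V_det_ne N ν hν)]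
end
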